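/- Let (x_p)_{p≥1} be a summable sequence of nonnegative real numbers. Then lim_{u → 0+} (1/u) · ( ∏_{p=1}^{∞} 1/(1 + u·x_p) − 1 ) = − Σ_{p=1}^{∞} x_p. -/

import Mathlib

open Filter Topology

theorem Finset.one_add_sum_le_prod_one_add {ι : Type*} (s : Finset ι) {f : ι → ℝ}
    (hf : ∀ i, 0 ≤ f i) : 1 + ∑ i ∈ s, f i ≤ ∏ i ∈ s, (1 + f i) := by
  classical
  induction s using Finset.induction_on with
  | empty => simp
  | insert a s ha ih =>
    rw [Finset.sum_insert ha, Finset.prod_insert ha]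
    nlinarith [hf a, mul_nonneg (hf a) (Finset.sum_nonneg fun i (_ : i ∈ s) => hf i),
      mul_le_mul_of_nonneg_left ih (hf a)]

theorem tprod_one_div_one_add_mem_Icc {ι : Type*} {f : ι → ℝ} (hf : ∀ i, 0 ≤ f i)
    (hs : Summable f) :
    ∏' i, 1 / (1 + f i) ∈ Set.Icc (1 - ∑' i, f i) (1 / (1 + ∑' i, f i)) := by
  have hQ : HasProd (fun i => 1 + f i) (∏' i, (1 + f i)) :=
    (Real.multipliable_one_add_of_summable hs).hasProd
  have hlower : 1 + ∑' i, f i ≤ ∏' i, (1 + f i) :=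
    le_of_tendsto_of_tendsto' (hs.hasSum.const_add 1) hQ
      fun s => s.one_add_sum_le_prod_one_add hf
  have hupper : ∏' i, (1 + f i) ≤ Real.exp (∑' i, f i) :=
    le_of_tendsto_of_tendsto' hQ (Real.continuous_exp.continuousAt.tendsto.comp hs.hasSum)
      fun s => Real.prod_one_add_le_exp_sum s fun i => hf i
  have hS : 0 ≤ ∑' i, f i := tsum_nonneg hf
  have hpos : 0 < ∏' i, (1 + f i) := by linarith
  have hinv : ∏' i, 1 / (1 + f i) = 1 / ∏' i, (1 + f i) := by
    simp only [one_div]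
    exact (hQ.inv₀ hpos.ne').tprod_eq
  rw [hinv]
  refine ⟨?_, one_div_le_one_div_of_le (by linarith) hlower⟩
  calc 1 - ∑' i, f i ≤ Real.exp (-∑' i, f i) := by
        linarith [Real.add_one_le_exp (-∑' i, f i)]
    _ = 1 / Real.exp (∑' i, f i) := by rw [Real.exp_neg, one_div]
    _ ≤ 1 / ∏' i, (1 + f i) := one_div_le_one_div_of_le hpos hupper

theorem infinite_product_derivative_at_zero
    (x : ℕ → ℝ) (hx : ∀ p, 0 ≤ x p) (hsum : Summable x) :
    Tendsto (fun u : ℝ => (1 / u) * ((∏' p : ℕ, 1 / (1 + u * x p)) - 1))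
      (𝓝[>] 0) (𝓝 (-∑' p : ℕ, x p)) := by
  have hS : 0 ≤ ∑' p, x p := tsum_nonneg hx
  have hbounds (u : ℝ) (hu : 0 < u) :=
    tprod_one_div_one_add_mem_Icc (fun p => mul_nonneg hu.le (hx p)) (hsum.mul_left u)
  simp only [tsum_mul_left, Set.mem_Icc] at hbounds
  have hlim : Tendsto (fun u : ℝ => -(∑' p, x p) / (1 + u * ∑' p, x p))
      (𝓝[>] 0) (𝓝 (-∑' p, x p)) := by
    have hc : ContinuousAt (fun u : ℝ => -(∑' p, x p) / (1 + u * ∑' p, x p)) 0 :=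
      ContinuousAt.div (by fun_prop) (by fun_prop) (by simp)
    simpa using hc.tendsto.mono_left nhdsWithin_le_nhds
  refine tendsto_of_tendsto_of_tendsto_of_le_of_le' tendsto_const_nhds hlim ?_ ?_
  · filter_upwards [self_mem_nhdsWithin] with u hu
    have hu : 0 < u := hu
    rw [one_div_mul_eq_div, le_div_iff₀ hu]
    linarith [(hbounds u hu).1]
  · filter_upwards [self_mem_nhdsWithin] with u hu
    have hu : 0 < u := hu
    have hden : 0 < 1 + u * ∑' p, x p := by positivity
    have heq : 1 / (1 + u * ∑' p, x p) - 1 = -(∑' p, x p) / (1 + u * ∑' p, x p) * u := by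
      field_simp
      ring
    rw [one_div_mul_eq_div, div_le_iff₀ hu, ← heq]
    linarith [(hbounds u hu).2]
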